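/- arXiv:2002.04832 — 5 statements merged into one kernel-verified Lean document; each statement's English description precedes it below -/
import Mathlib

section
/- Let Assumption (M) hold and let (X_t) be a Markov chain with kernel Q started from any initial law. Then for every n ∈ ℕ and all integers 1 ≤ s < t, ‖L(X_t) − L(X_s)‖_TV ≤ 4 sup_{k∈ℕ} P(X_k ∉ 𝒳_n) + 2(1 − α_n)^s. -/
open MeasureTheory ProbabilityTheory Filter

/-- Total variation distance between two measures, defined as in the paper:
`‖μ − ν‖_TV = sup_{|φ|≤1} |∫ φ dμ − ∫ φ dν|`. -/
noncomputable def tvDist {X : Type*} [MeasurableSpace X] (μ ν : Measure X) : ℝ :=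
  ⨆ φ : {φ : X → ℝ // Measurable φ ∧ ∀ x, |φ x| ≤ 1},
    |∫ x, φ.1 x ∂μ - ∫ x, φ.1 x ∂ν|

/-- A bounded measurable function integrates against two probability measures, one of which
dominates `a` times the other, to values that agree up to the undominated mass. -/
lemma abs_integral_sub_mul_integral_le {X : Type*} [MeasurableSpace X] {ρ q : Measure X}
    [IsProbabilityMeasure ρ] [IsProbabilityMeasure q] {a b : ℝ} (ha : 0 ≤ a)
    (hle : ENNReal.ofReal a • ρ ≤ q) {φ : X → ℝ} (hφ : Measurable φ) (hb : ∀ x, |φ x| ≤ b) :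
    |∫ x, φ x ∂q - a * ∫ x, φ x ∂ρ| ≤ b * (1 - a) := by
  have hint (m : Measure X) [IsProbabilityMeasure m] : Integrable φ m :=
    Integrable.of_bound hφ.aestronglyMeasurable b (ae_of_all _ hb)
  have hq := hint q
  have hρ := hint ρ
  have h₁ := integral_mono_measure (f := fun x => b - φ x) hle
    (ae_of_all _ fun x => sub_nonneg.2 (abs_le.1 (hb x)).2) ((integrable_const b).sub hq)
  have h₂ := integral_mono_measure (f := fun x => b + φ x) hle
    (ae_of_all _ fun x => neg_le_iff_add_nonneg'.1 (abs_le.1 (hb x)).1)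
    ((integrable_const b).add hq)
  rw [integral_smul_measure, ENNReal.toReal_ofReal ha, integral_sub (integrable_const b) hρ,
    integral_sub (integrable_const b) hq] at h₁
  rw [integral_smul_measure, ENNReal.toReal_ofReal ha, integral_add (integrable_const b) hρ,
    integral_add (integrable_const b) hq] at h₂
  simp only [integral_const, probReal_univ, smul_eq_mul, one_mul] at h₁ h₂
  rw [abs_le]
  constructor <;> linarith

lemma abs_integral_le_of_abs_le {X : Type*} [MeasurableSpace X] (m : Measure X)
    [IsProbabilityMeasure m] {φ : X → ℝ} {b : ℝ} (hb : ∀ x, |φ x| ≤ b) :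
    |∫ x, φ x ∂m| ≤ b := by
  simpa using norm_integral_le_of_norm_le_const (μ := m) (f := φ) (ae_of_all _ hb)

lemma abs_integral_indicator_le {X : Type*} [MeasurableSpace X] (m : Measure X)
    [IsProbabilityMeasure m] {B : Set X} (hB : MeasurableSet B) {f : X → ℝ} {b : ℝ}
    (hb : ∀ x, |f x| ≤ b) : |∫ x, B.indicator f x ∂m| ≤ b * m.real B := by
  rw [integral_indicator hB]
  exact norm_setIntegral_le_of_norm_le_const (f := f) (measure_lt_top m B) fun x _ => hb x

/-- Two chains whose kernel is minorized on a set `C`, and which leave `C` with probability at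
most `ε` at each time, merge geometrically up to an error `4 * ε`. -/
lemma abs_integral_sub_le_of_minorization {X : Type*} [MeasurableSpace X] (Q : Kernel X X)
    [IsMarkovKernel Q] {C : Set X} (hC : MeasurableSet C) {a : ℝ} (ha : a ∈ Set.Ioc (0 : ℝ) 1)
    (ρ : Measure X) [IsProbabilityMeasure ρ] (hQ : ∀ x ∈ C, ENNReal.ofReal a • ρ ≤ Q x)
    {μ₁ μ₂ : ℕ → Measure X} [∀ k, IsProbabilityMeasure (μ₁ k)]
    [∀ k, IsProbabilityMeasure (μ₂ k)] (h₁ : ∀ k, μ₁ (k + 1) = (μ₁ k).bind Q)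
    (h₂ : ∀ k, μ₂ (k + 1) = (μ₂ k).bind Q) {ε : ℝ} (hε₁ : ∀ k, (μ₁ k).real Cᶜ ≤ ε)
    (hε₂ : ∀ k, (μ₂ k).real Cᶜ ≤ ε) (s : ℕ) {b : ℝ} {φ : X → ℝ} (hφ : Measurable φ)
    (hb : ∀ x, |φ x| ≤ b) :
    |∫ x, φ x ∂μ₁ s - ∫ x, φ x ∂μ₂ s| ≤ b * (4 * ε + 2 * (1 - a) ^ s) := by
  obtain ⟨x₀⟩ := nonempty_of_isProbabilityMeasure ρ
  have hε : 0 ≤ ε := measureReal_nonneg.trans (hε₁ 0)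
  induction s generalizing b φ with
  | zero =>
    have hb₀ : 0 ≤ b := (abs_nonneg _).trans (hb x₀)
    have := abs_le.1 (abs_integral_le_of_abs_le (μ₁ 0) hb)
    have := abs_le.1 (abs_integral_le_of_abs_le (μ₂ 0) hb)
    have := mul_nonneg hb₀ hε
    rw [abs_le]
    constructor <;> linarith
  | succ s ih =>
    have hb₀ : 0 ≤ b := (abs_nonneg _).trans (hb x₀)
    set F : X → ℝ := fun x => ∫ y, φ y ∂Q x with hF
    set c : ℝ := ∫ y, φ y ∂ρ
    set u : X → ℝ := Cᶜ.indicator fun x => F x - c with hu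
    set g : X → ℝ := fun x => F x - a * c - a * u x with hg
    have hFm : Measurable F := hφ.stronglyMeasurable.integral_kernel.measurable
    have hum : Measurable u := (hFm.sub_const c).indicator hC.compl
    have hgm : Measurable g := (hFm.sub_const _).sub (hum.const_mul a)
    have hFb (x : X) : |F x| ≤ b := abs_integral_le_of_abs_le _ hb
    have hcb : |c| ≤ b := abs_integral_le_of_abs_le _ hb
    have hFcb (x : X) : |F x - c| ≤ 2 * b := (abs_sub _ _).trans (by linarith [hFb x])
    have hub (x : X) : |u x| ≤ 2 * b := by
      by_cases hx : x ∈ C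
      · simp [hu, hx, hb₀]
      · simpa [hu, hx] using hFcb x
    have hgb (x : X) : |g x| ≤ b * (1 - a) := by
      by_cases hx : x ∈ C
      · simpa [hg, hu, hx] using abs_integral_sub_mul_integral_le ha.1.le (hQ x hx) hφ hb
      · have : g x = F x * (1 - a) := by simp [hg, hu, hx]; ring
        rw [this, abs_mul, abs_of_nonneg (sub_nonneg.2 ha.2)]
        exact mul_le_mul_of_nonneg_right (hFb x) (sub_nonneg.2 ha.2)
    have hstep (m : Measure X) [IsProbabilityMeasure m] [IsProbabilityMeasure (m.bind Q)] :
        ∫ x, φ x ∂(m.bind Q) = ∫ x, g x ∂m + a * c + a * ∫ x, u x ∂m := by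
      have hFi : Integrable F m := .of_bound hFm.aestronglyMeasurable _ (ae_of_all _ hFb)
      have hui : Integrable u m := .of_bound hum.aestronglyMeasurable _ (ae_of_all _ hub)
      have hbind : ∫ x, φ x ∂(m.bind Q) = ∫ x, F x ∂m := by
        have hφi : Integrable φ (m.bind Q) :=
          .of_bound hφ.aestronglyMeasurable b (ae_of_all _ hb)
        rw [Measure.comp_eq_comp_const_apply] at hφi ⊢
        rw [Kernel.integral_comp hφi, Kernel.const_apply]
      have hgF : ∫ x, g x ∂m = ∫ x, F x ∂m - a * c - a * ∫ x, u x ∂m := by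
        rw [hg, integral_sub (by fun_prop) (by fun_prop), integral_sub hFi (by fun_prop),
          integral_const_mul a u]
        simp
      rw [hbind, hgF]
      ring
    have hp₁ : IsProbabilityMeasure ((μ₁ s).bind Q) := h₁ s ▸ inferInstance
    have hp₂ : IsProbabilityMeasure ((μ₂ s).bind Q) := h₂ s ▸ inferInstance
    have huε (m : Measure X) [IsProbabilityMeasure m] (hm : m.real Cᶜ ≤ ε) :
        |∫ x, u x ∂m| ≤ 2 * b * ε :=
      (abs_integral_indicator_le m hC.compl hFcb).trans
        (mul_le_mul_of_nonneg_left hm (by positivity))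
    have hu₁₂ : |∫ x, u x ∂μ₁ s - ∫ x, u x ∂μ₂ s| ≤ 4 * b * ε :=
      (abs_sub _ _).trans (by linarith [huε (μ₁ s) (hε₁ s), huε (μ₂ s) (hε₂ s)])
    rw [h₁, h₂, hstep, hstep]
    calc _ = |(∫ x, g x ∂μ₁ s - ∫ x, g x ∂μ₂ s)
          + a * (∫ x, u x ∂μ₁ s - ∫ x, u x ∂μ₂ s)| := by congr 1; ring
      _ ≤ |∫ x, g x ∂μ₁ s - ∫ x, g x ∂μ₂ s| + a * |∫ x, u x ∂μ₁ s - ∫ x, u x ∂μ₂ s| :=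
          (abs_add_le _ _).trans_eq (by rw [abs_mul a, abs_of_pos ha.1])
      _ ≤ b * (1 - a) * (4 * ε + 2 * (1 - a) ^ s) + a * (4 * b * ε) :=
          add_le_add (ih hgm hgb) (mul_le_mul_of_nonneg_left hu₁₂ ha.1.le)
      _ = _ := by ring

theorem tv_cauchy_estimate
    {𝒳 : Type*} [MeasurableSpace 𝒳] [TopologicalSpace 𝒳] [PolishSpace 𝒳] [BorelSpace 𝒳]
    (Q : Kernel 𝒳 𝒳) [IsMarkovKernel Q]
    (Xs : ℕ → Set 𝒳) (hXsmeas : ∀ n, MeasurableSet (Xs n)) (hXsmono : Monotone Xs)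
    (hXs0 : (Xs 0).Nonempty)
    -- Assumption (M): minorization on each 𝒳ₙ
    (α : ℕ → ℝ) (hα : ∀ n, α n ∈ Set.Ioc (0:ℝ) 1) (hαanti : Antitone α)
    (ν : ℕ → Measure 𝒳) (hν : ∀ n, IsProbabilityMeasure (ν n))
    (hminor : ∀ n, ∀ x ∈ Xs n, ∀ A : Set 𝒳, MeasurableSet A →
      ENNReal.ofReal (α n) * ν n A ≤ Q x A)
    -- (μ t) are the marginal laws of a Markov chain with kernel Q, any initial law
    (μ : ℕ → Measure 𝒳) (hμprob : ∀ t, IsProbabilityMeasure (μ t))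
    (hμchain : ∀ t, μ (t + 1) = (μ t).bind (fun x => Q x)) :
    ∀ n : ℕ, ∀ s t : ℕ, 1 ≤ s → s < t →
      tvDist (μ t) (μ s) ≤ 4 * (⨆ k, μ k (Xs n)ᶜ).toReal + 2 * (1 - α n) ^ s := by
  intro n s t _ hst
  have hprob := hν n
  have hfin : (⨆ k, μ k (Xs n)ᶜ) ≠ ⊤ :=
    ((iSup_le fun k => prob_le_one).trans_lt ENNReal.one_lt_top).ne
  have hε (k : ℕ) : (μ k).real (Xs n)ᶜ ≤ (⨆ k, μ k (Xs n)ᶜ).toReal :=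
    ENNReal.toReal_mono hfin (le_iSup (fun k => μ k (Xs n)ᶜ) k)
  have : Nonempty {φ : 𝒳 → ℝ // Measurable φ ∧ ∀ x, |φ x| ≤ 1} :=
    ⟨⟨fun _ => 0, measurable_const, by simp⟩⟩
  refine ciSup_le fun φ => ?_
  have h := abs_integral_sub_le_of_minorization Q (hXsmeas n) (hα n) (ν n)
    (fun x hx => Measure.le_iff.2 fun A hA => hminor n x hx A hA)
    (μ₁ := fun k => μ (k + (t - s))) (μ₂ := μ)
    (fun k => by rw [← hμchain, Nat.add_right_comm]) hμchain
    (fun k => hε _) hε s φ.2.1 φ.2.2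
  simpa only [one_mul, Nat.add_sub_cancel' hst.le] using h
end

section
/- Let Assumption (M) hold. If (X_t) and (X'_t) are Markov chains with the same kernel Q started from initial laws L(X_0) ∈ 𝔓_b and L(X'_0) ∈ 𝔓_b respectively, then ‖L(X_t) − L(X'_t)‖_TV → 0 as t → ∞; in particular the limit measure μ* of L(X_t) in total variation does not depend on the choice of the initial law in 𝔓_b. -/
open MeasureTheory ProbabilityTheory Filter

open scoped ENNReal

section TotalVariation

variable {X : Type*} [MeasurableSpace X] {μ ν : Measure X}

theorem add_sub_eq_add_sub [IsFiniteMeasure μ] [IsFiniteMeasure ν] :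
    μ + (ν - μ) = ν + (μ - ν) := by
  rw [← Measure.toSignedMeasure_eq_toSignedMeasure_iff, Measure.toSignedMeasure_add,
    Measure.toSignedMeasure_add]
  have h := Measure.sub_toSignedMeasure_eq_toSignedMeasure_sub (μ := μ) (ν := ν)
  rw [sub_eq_sub_iff_add_eq_add] at h
  rw [h, add_comm]

theorem measureReal_sub_univ_comm [IsProbabilityMeasure μ] [IsProbabilityMeasure ν] :
    (ν - μ).real Set.univ = (μ - ν).real Set.univ := by
  have h := congrArg (fun m : Measure X => m.real Set.univ) (add_sub_eq_add_sub (μ := μ) (ν := ν))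
  simpa [measureReal_add_apply] using h

theorem abs_integral_le_measureReal_univ [IsFiniteMeasure μ] {φ : X → ℝ} (hφ : ∀ x, |φ x| ≤ 1) :
    |∫ x, φ x ∂μ| ≤ μ.real Set.univ := by
  simpa using norm_integral_le_of_norm_le_const (μ := μ) (f := φ) (C := 1) (.of_forall hφ)

theorem integrable_of_abs_le_one [IsFiniteMeasure μ] {φ : X → ℝ} (hφm : Measurable φ)
    (hφ : ∀ x, |φ x| ≤ 1) : Integrable φ μ :=
  .of_bound hφm.aestronglyMeasurable 1 (.of_forall hφ)

theorem tvDist_nonneg : 0 ≤ tvDist μ ν := Real.iSup_nonneg fun _ => abs_nonneg _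

theorem tvDist_le {C : ℝ}
    (h : ∀ φ : X → ℝ, Measurable φ → (∀ x, |φ x| ≤ 1) → |∫ x, φ x ∂μ - ∫ x, φ x ∂ν| ≤ C) :
    tvDist μ ν ≤ C :=
  haveI : Nonempty {φ : X → ℝ // Measurable φ ∧ ∀ x, |φ x| ≤ 1} :=
    ⟨⟨0, measurable_zero, by simp⟩⟩
  ciSup_le fun φ => h φ.1 φ.2.1 φ.2.2

theorem abs_integral_sub_le_tvDist [IsFiniteMeasure μ] [IsFiniteMeasure ν] {φ : X → ℝ}
    (hφm : Measurable φ) (hφ : ∀ x, |φ x| ≤ 1) :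
    |∫ x, φ x ∂μ - ∫ x, φ x ∂ν| ≤ tvDist μ ν := by
  refine le_ciSup (f := fun φ : {φ : X → ℝ // Measurable φ ∧ ∀ x, |φ x| ≤ 1} =>
    |∫ x, φ.1 x ∂μ - ∫ x, φ.1 x ∂ν|) ?_ ⟨φ, hφm, hφ⟩
  refine ⟨μ.real Set.univ + ν.real Set.univ, ?_⟩
  rintro _ ⟨ψ, rfl⟩
  exact (abs_sub _ _).trans (add_le_add (abs_integral_le_measureReal_univ ψ.2.2)
    (abs_integral_le_measureReal_univ ψ.2.2))

theorem tvDist_triangle_left {ξ : Measure X} [IsFiniteMeasure μ] [IsFiniteMeasure ν]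
    [IsFiniteMeasure ξ] : tvDist ν ξ ≤ tvDist μ ν + tvDist μ ξ := by
  refine tvDist_le fun φ hφm hφ => ?_
  have h₁ := abs_integral_sub_le_tvDist (μ := μ) (ν := ν) hφm hφ
  have h₂ := abs_integral_sub_le_tvDist (μ := μ) (ν := ξ) hφm hφ
  rw [abs_le] at *
  constructor <;> linarith

theorem tvDist_le_two_mul_measureReal_sub [IsProbabilityMeasure μ] [IsProbabilityMeasure ν] :
    tvDist μ ν ≤ 2 * (μ - ν).real Set.univ := by
  refine tvDist_le fun φ hφm hφ => ?_
  have h := congrArg (fun m : Measure X => ∫ x, φ x ∂m) (add_sub_eq_add_sub (μ := μ) (ν := ν))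
  rw [integral_add_measure (integrable_of_abs_le_one hφm hφ) (integrable_of_abs_le_one hφm hφ),
    integral_add_measure (integrable_of_abs_le_one hφm hφ) (integrable_of_abs_le_one hφm hφ)] at h
  have h₁ := abs_integral_le_measureReal_univ (μ := μ - ν) hφ
  have h₂ := abs_integral_le_measureReal_univ (μ := ν - μ) hφ
  rw [measureReal_sub_univ_comm] at h₂
  rw [abs_le] at *
  constructor <;> linarith

end TotalVariation

section Minorization

variable {X : Type*} [MeasurableSpace X] {Q : Kernel X X} {s : Set X} {a e : ℝ} {η : Measure X}

theorem smul_le_bind_of_minorization {ρ : Measure X} {b : ℝ≥0∞}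
    (hQ : ∀ x ∈ s, ∀ A : Set X, MeasurableSet A → b * η A ≤ Q x A) :
    (b * ρ s) • η ≤ ρ.bind (fun x => Q x) := by
  refine Measure.le_iff.2 fun A hA => ?_
  rw [Measure.bind_apply hA Q.measurable.aemeasurable]
  calc ((b * ρ s) • η) A = ∫⁻ _ in s, b * η A ∂ρ := by
        simp [mul_right_comm]
    _ ≤ ∫⁻ x in s, Q x A ∂ρ := setLIntegral_mono (Q.measurable_coe hA) fun x hx => hQ x hx A hA
    _ ≤ ∫⁻ x, Q x A ∂ρ := setLIntegral_le_lintegral _ _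

theorem ofReal_smul_le_bind_of_le {μ ρ : Measure X} [IsFiniteMeasure ρ] (hρ : ρ ≤ μ)
    (hs : MeasurableSet s) (ha : 0 ≤ a) (he : 0 ≤ e) (hμ : μ sᶜ ≤ ENNReal.ofReal e)
    (hQ : ∀ x ∈ s, ∀ A : Set X, MeasurableSet A → ENNReal.ofReal a * η A ≤ Q x A) :
    ENNReal.ofReal (a * max (ρ.real Set.univ - e) 0) • η ≤ ρ.bind (fun x => Q x) := by
  refine le_trans ?_ (smul_le_bind_of_minorization hQ)
  have h₁ : ρ.real sᶜ ≤ e := ENNReal.toReal_le_of_le_ofReal he ((hρ _).trans hμ)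
  have h₂ : max (ρ.real Set.univ - e) 0 ≤ ρ.real s := by
    rw [← measureReal_add_measureReal_compl hs]
    exact max_le (by linarith) measureReal_nonneg
  have h₃ : ENNReal.ofReal (a * max (ρ.real Set.univ - e) 0) ≤ ENNReal.ofReal a * ρ s := by
    rw [ENNReal.ofReal_mul ha, ← ofReal_measureReal (μ := ρ) (s := s)]
    gcongr
  exact Measure.le_iff.2 fun A _ => by
    simp only [Measure.smul_apply, smul_eq_mul]
    gcongr

/-- One step of the chain removes from the part of `μ` not matched with `μ'` a fixed fraction of
its mass in excess of `e`. -/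
theorem measureReal_bind_sub_bind_add_le [IsMarkovKernel Q] {μ μ' : Measure X}
    [IsProbabilityMeasure μ] [IsProbabilityMeasure μ'] [IsProbabilityMeasure η]
    (hs : MeasurableSet s) (ha : 0 ≤ a) (he : 0 ≤ e)
    (hμ : μ sᶜ ≤ ENNReal.ofReal e) (hμ' : μ' sᶜ ≤ ENNReal.ofReal e)
    (hQ : ∀ x ∈ s, ∀ A : Set X, MeasurableSet A → ENNReal.ofReal a * η A ≤ Q x A) :
    (μ.bind (fun x => Q x) - μ'.bind (fun x => Q x)).real Set.univ
      + a * max ((μ - μ').real Set.univ - e) 0 ≤ (μ - μ').real Set.univ := by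
  set c := a * max ((μ - μ').real Set.univ - e) 0 with hc
  have hc0 : 0 ≤ c := mul_nonneg ha (le_max_right _ _)
  have h₁ : ENNReal.ofReal c • η ≤ (μ - μ').bind (fun x => Q x) :=
    ofReal_smul_le_bind_of_le Measure.sub_le hs ha he hμ hQ
  have h₂ : ENNReal.ofReal c • η ≤ (μ' - μ).bind (fun x => Q x) := by
    rw [hc, ← measureReal_sub_univ_comm]
    exact ofReal_smul_le_bind_of_le Measure.sub_le hs ha he hμ' hQ
  have : IsFiniteMeasure (ENNReal.ofReal c • η) := Measure.smul_finite _ ENNReal.ofReal_ne_top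
  set σ := (μ - μ').bind (fun x => Q x) - ENNReal.ofReal c • η
  set σ' := (μ' - μ).bind (fun x => Q x) - ENNReal.ofReal c • η
  have hσ : σ + ENNReal.ofReal c • η = (μ - μ').bind (fun x => Q x) :=
    Measure.sub_add_cancel_of_le h₁
  have hσ' : σ' + ENNReal.ofReal c • η = (μ' - μ).bind (fun x => Q x) :=
    Measure.sub_add_cancel_of_le h₂
  have hbind : μ.bind (fun x => Q x) + σ' = μ'.bind (fun x => Q x) + σ := by
    have h := congrArg (fun m : Measure X => m.bind (fun x => Q x))
      (add_sub_eq_add_sub (μ := μ) (ν := μ'))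
    simp only [Measure.comp_add, ← hσ, ← hσ', ← add_assoc] at h
    have h' := congrArg (· - ENNReal.ofReal c • η) h
    simpa only [Measure.add_sub_cancel] using h'
  have hle : μ.bind (fun x => Q x) - μ'.bind (fun x => Q x) ≤ σ := by
    refine Measure.sub_le_of_le_add ?_
    rw [add_comm, ← hbind]
    exact Measure.le_add_right le_rfl
  have hmass : σ.real Set.univ + c = (μ - μ').real Set.univ := by
    have : IsFiniteMeasure σ := Measure.isFiniteMeasure_sub
    have h := congrArg (fun m : Measure X => m.real Set.univ) hσ
    rw [measureReal_add_apply, measureReal_ennreal_smul_apply] at h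
    simpa [hc0, Measure.real, Measure.bind_apply MeasurableSet.univ Q.measurable.aemeasurable]
      using h
  have : (μ.bind (fun x => Q x) - μ'.bind (fun x => Q x)).real Set.univ ≤ σ.real Set.univ :=
    ENNReal.toReal_mono (measure_ne_top _ _) (hle _)
  linarith

end Minorization

theorem sub_le_one_sub_pow {d : ℕ → ℝ} {a e : ℝ} (ha1 : a ≤ 1) (h0 : d 0 ≤ 1) (he : 0 ≤ e)
    (hd : ∀ t, d (t + 1) + a * max (d t - e) 0 ≤ d t) (t : ℕ) :
    d t - e ≤ (1 - a) ^ t := by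
  induction t with
  | zero => simpa using by linarith
  | succ t ih =>
    have h := hd t
    have hpow := pow_nonneg (sub_nonneg.2 ha1) (t + 1)
    rcases le_total (d t - e) 0 with hneg | hpos
    · rw [max_eq_right hneg] at h
      linarith
    · rw [max_eq_left hpos] at h
      rw [pow_succ']
      nlinarith [mul_le_mul_of_nonneg_left ih (sub_nonneg.2 ha1)]

theorem limit_independent_of_initial_law
    {𝒳 : Type*} [MeasurableSpace 𝒳] [TopologicalSpace 𝒳] [PolishSpace 𝒳] [BorelSpace 𝒳]
    (Q : Kernel 𝒳 𝒳) [IsMarkovKernel Q]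
    (Xs : ℕ → Set 𝒳) (hXsmeas : ∀ n, MeasurableSet (Xs n)) (hXsmono : Monotone Xs)
    (hXs0 : (Xs 0).Nonempty)
    -- Assumption (M): minorization on each 𝒳ₙ
    (α : ℕ → ℝ) (hα : ∀ n, α n ∈ Set.Ioc (0:ℝ) 1) (hαanti : Antitone α)
    (ν : ℕ → Measure 𝒳) (hν : ∀ n, IsProbabilityMeasure (ν n))
    (hminor : ∀ n, ∀ x ∈ Xs n, ∀ A : Set 𝒳, MeasurableSet A →
      ENNReal.ofReal (α n) * ν n A ≤ Q x A)
    -- (μ t) and (μ' t): marginal laws of two Markov chains with kernel Q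
    (μ μ' : ℕ → Measure 𝒳)
    (hμprob : ∀ t, IsProbabilityMeasure (μ t)) (hμ'prob : ∀ t, IsProbabilityMeasure (μ' t))
    (hμchain : ∀ t, μ (t + 1) = (μ t).bind (fun x => Q x))
    (hμ'chain : ∀ t, μ' (t + 1) = (μ' t).bind (fun x => Q x))
    -- both initial laws lie in 𝔓_b
    (hμtight : Tendsto (fun n => ⨆ t, μ t (Xs n)ᶜ) atTop (nhds 0))
    (hμ'tight : Tendsto (fun n => ⨆ t, μ' t (Xs n)ᶜ) atTop (nhds 0)) :
    Tendsto (fun t => tvDist (μ t) (μ' t)) atTop (nhds 0) ∧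
    ∀ μstar : Measure 𝒳, IsProbabilityMeasure μstar →
      Tendsto (fun t => tvDist (μ t) μstar) atTop (nhds 0) →
      Tendsto (fun t => tvDist (μ' t) μstar) atTop (nhds 0) := by
  have hfirst : Tendsto (fun t => tvDist (μ t) (μ' t)) atTop (nhds 0) := by
    rw [Metric.tendsto_atTop]
    intro ε hε
    have hε4 : (0 : ℝ≥0∞) < ENNReal.ofReal (ε / 4) := ENNReal.ofReal_pos.2 (by linarith)
    obtain ⟨n, hn, hn'⟩ :=
      ((hμtight.eventually_lt_const hε4).and (hμ'tight.eventually_lt_const hε4)).exists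
    have hdecay := sub_le_one_sub_pow (d := fun t => (μ t - μ' t).real Set.univ)
      (a := α n) (e := ε / 4) (hα n).2
      ((ENNReal.toReal_mono (measure_ne_top _ _) (Measure.sub_le (μ := μ 0) _)).trans
        measureReal_le_one) (by linarith)
      (fun t => by
        simp only [hμchain t, hμ'chain t]
        exact measureReal_bind_sub_bind_add_le (hXsmeas n) (hα n).1.le (by linarith)
          ((le_iSup (fun t => μ t (Xs n)ᶜ) t).trans hn.le)
          ((le_iSup (fun t => μ' t (Xs n)ᶜ) t).trans hn'.le) (hminor n))
    have hpow := tendsto_pow_atTop_nhds_zero_of_lt_one (r := 1 - α n)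
      (by linarith [(hα n).2]) (by linarith [(hα n).1])
    obtain ⟨N, hN⟩ := eventually_atTop.1 (hpow.eventually_lt_const (show 0 < ε / 4 by linarith))
    refine ⟨N, fun t ht => ?_⟩
    rw [Real.dist_eq, sub_zero, abs_of_nonneg tvDist_nonneg]
    have h₁ := hdecay t
    have h₂ := hN t ht
    have h₃ := tvDist_le_two_mul_measureReal_sub (μ := μ t) (ν := μ' t)
    linarith
  refine ⟨hfirst, fun μstar _ hstar => ?_⟩
  exact squeeze_zero (fun _ => tvDist_nonneg) (fun _ => tvDist_triangle_left)
    (by simpa using hfirst.add hstar)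
end

section
/- Let Assumption (M) hold and let U = (U¹, U²) be uniformly distributed on [0,1]². For each n ∈ ℕ there exists a jointly measurable mapping Tⁿ: [0,1]² × 𝒳 → 𝒳 such that (i) for every x ∈ 𝒳 and Borel A ⊆ 𝒳, Q(x, A) = P(Tⁿ(U, x) ∈ A), and (ii) for every u₁ ∈ [0, α_n], every u₂ ∈ [0,1] and all x₁, x₂ ∈ 𝒳_n, Tⁿ(u₁, u₂, x₁) = Tⁿ(u₁, u₂, x₂). -/
open MeasureTheory ProbabilityTheory Filter

/-- A Markov kernel minorized on `S` by `a • ν` splits there as a mixture of `ν` and a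
residual Markov kernel, which agrees with the original kernel outside `S`. -/
theorem ProbabilityTheory.Kernel.exists_residual
    {X Y : Type*} [MeasurableSpace X] [MeasurableSpace Y]
    (Q : Kernel X Y) [IsMarkovKernel Q] {S : Set X} (hS : MeasurableSet S)
    {a : ENNReal} (ha : a ≤ 1) (ν : Measure Y) [IsProbabilityMeasure ν]
    (hQ : ∀ x ∈ S, a • ν ≤ Q x) :
    ∃ R : Kernel X Y, IsMarkovKernel R ∧
      (∀ x ∈ S, Q x = a • ν + (1 - a) • R x) ∧ ∀ x ∉ S, R x = Q x := by
  classical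
  rcases ha.eq_or_lt with rfl | ha1
  · refine ⟨Q, inferInstance, fun x hx ↦ ?_, fun _ _ ↦ rfl⟩
    have h := hQ x hx
    simp only [one_smul] at h
    simpa using (Measure.eq_of_le_of_measure_univ_eq h (by simp)).symm
  have ha_top : a ≠ ⊤ := (ha1.trans ENNReal.one_lt_top).ne
  have h0 : 1 - a ≠ 0 := (tsub_pos_of_lt ha1).ne'
  have h_top : 1 - a ≠ ⊤ := ENNReal.sub_ne_top ENNReal.one_ne_top
  have : IsFiniteMeasure (a • ν) := Measure.smul_finite ν ha_top
  let r : X → Measure Y := fun x ↦ if x ∈ S then (1 - a)⁻¹ • (Q x - a • ν) else Q x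
  have hr : Measurable r := by
    refine Measure.measurable_of_measurable_coe _ fun A hA ↦ ?_
    have h_eq : (fun x ↦ r x A) =
        fun x ↦ if x ∈ S then (1 - a)⁻¹ * (Q x A - a * ν A) else Q x A := by
      ext x
      by_cases hx : x ∈ S
      · simp [r, hx, Measure.sub_apply hA (hQ x hx)]
      · simp [r, hx]
    rw [h_eq]
    have hQA := Q.measurable_coe hA
    exact Measurable.ite hS (by fun_prop) hQA
  refine ⟨⟨r, hr⟩, ⟨fun x ↦ ⟨?_⟩⟩, fun x hx ↦ ?_, fun x hx ↦ ?_⟩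
  · change r x Set.univ = 1
    by_cases hx : x ∈ S
    · simp [r, hx, Measure.sub_apply MeasurableSet.univ (hQ x hx), ENNReal.inv_mul_cancel h0 h_top]
    · simp [r, hx]
  · change Q x = a • ν + (1 - a) • r x
    simp only [r, hx, if_true, smul_smul, ENNReal.mul_inv_cancel h0 h_top, one_smul]
    rw [add_comm, Measure.sub_add_cancel_of_le (hQ x hx)]
  · change r x = Q x
    simp [r, hx]

theorem unitInterval.map_projIcc_restrict_volume :
    (volume.restrict (Set.Icc (0:ℝ) 1)).map (Set.projIcc 0 1 zero_le_one) =
      (volume : Measure unitInterval) := by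
  have hval : (volume : Measure unitInterval).map Subtype.val =
      volume.restrict (Set.Icc (0:ℝ) 1) := map_comap_subtype_coe measurableSet_Icc _
  have hproj : Measurable (Set.projIcc (0:ℝ) 1 zero_le_one) := continuous_projIcc.measurable
  rw [← hval, Measure.map_map hproj measurable_subtype_coe]
  have hid : Set.projIcc (0:ℝ) 1 zero_le_one ∘ Subtype.val = id := by
    ext x
    simp
  rw [hid, Measure.map_id]

/-- A Markov kernel into a standard Borel space is the image of the uniform measure on `[0, 1]`,
seen as a measure on `ℝ`, under a jointly measurable map. -/
theorem ProbabilityTheory.Kernel.exists_measurable_map_restrict_Icc_eq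
    {X Y : Type*} [MeasurableSpace X] [Nonempty Y] [MeasurableSpace Y] [StandardBorelSpace Y]
    (κ : Kernel X Y) [IsMarkovKernel κ] :
    ∃ f : X → ℝ → Y, Measurable (Function.uncurry f) ∧
      ∀ x, (volume.restrict (Set.Icc (0:ℝ) 1)).map (f x) = κ x := by
  obtain ⟨f, hf, hmap⟩ := κ.exists_measurable_map_eq_unitInterval
  have hproj : Measurable (Set.projIcc (0:ℝ) 1 zero_le_one) := continuous_projIcc.measurable
  refine ⟨fun x u ↦ f x (Set.projIcc 0 1 zero_le_one u), by fun_prop, fun x ↦ ?_⟩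
  rw [← hmap x, ← unitInterval.map_projIcc_restrict_volume,
    Measure.map_map hf.of_uncurry_left hproj]
  rfl

/-- Switching between two maps of the second coordinate according to whether the first one is
at most `a` turns the uniform measure on `[0, 1]²` into a mixture. -/
theorem MeasureTheory.Measure.map_prod_ite_le
    {Y : Type*} [MeasurableSpace Y] {a : ℝ} (ha : a ∈ Set.Icc (0:ℝ) 1)
    (μ : Measure ℝ) [SFinite μ] {g h : ℝ → Y} (hg : Measurable g) (hh : Measurable h) :
    ((volume.restrict (Set.Icc (0:ℝ) 1)).prod μ).map
        (fun u ↦ if u.1 ≤ a then g u.2 else h u.2) =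
      ENNReal.ofReal a • μ.map g + (1 - ENNReal.ofReal a) • μ.map h := by
  have hle : volume.restrict (Set.Icc (0:ℝ) 1) (Set.Iic a) = ENNReal.ofReal a := by
    have hinter : Set.Iic a ∩ Set.Icc 0 1 = Set.Icc 0 a := by
      ext x
      simp only [Set.mem_inter_iff, Set.mem_Iic, Set.mem_Icc]
      exact ⟨fun hx ↦ ⟨hx.2.1, hx.1⟩, fun hx ↦ ⟨hx.2, hx.1, hx.2.trans ha.2⟩⟩
    rw [Measure.restrict_apply measurableSet_Iic, hinter, Real.volume_Icc, sub_zero]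
  have hgt : volume.restrict (Set.Icc (0:ℝ) 1) (Set.Ioi a) = 1 - ENNReal.ofReal a := by
    have : IsProbabilityMeasure (volume.restrict (Set.Icc (0:ℝ) 1)) := ⟨by simp⟩
    rw [← Set.compl_Iic, prob_compl_eq_one_sub measurableSet_Iic, hle]
  have hmeas : Measurable fun u : ℝ × ℝ ↦ if u.1 ≤ a then g u.2 else h u.2 :=
    Measurable.ite (measurableSet_le measurable_fst measurable_const) (by fun_prop) (by fun_prop)
  ext A hA
  have hpre : (fun u : ℝ × ℝ ↦ if u.1 ≤ a then g u.2 else h u.2) ⁻¹' A =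
      Set.Iic a ×ˢ (g ⁻¹' A) ∪ Set.Ioi a ×ˢ (h ⁻¹' A) := by
    ext u
    by_cases hu : u.1 ≤ a
    · simp [hu]
    · simp [hu, not_le.mp hu]
  have hdisj : Disjoint (Set.Iic a ×ˢ (g ⁻¹' A)) (Set.Ioi a ×ˢ (h ⁻¹' A)) :=
    Set.Disjoint.set_prod_left (Set.Iic_disjoint_Ioi le_rfl) _ _
  rw [Measure.map_apply hmeas hA, hpre,
    measure_union hdisj (measurableSet_Ioi.prod (hh hA)), Measure.prod_prod, Measure.prod_prod,
    hle, hgt]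
  simp [Measure.map_apply hg hA, Measure.map_apply hh hA]

theorem random_mapping_representation
    {𝒳 : Type*} [MeasurableSpace 𝒳] [TopologicalSpace 𝒳] [PolishSpace 𝒳] [BorelSpace 𝒳]
    (Q : Kernel 𝒳 𝒳) [IsMarkovKernel Q]
    (Xs : ℕ → Set 𝒳) (hXsmeas : ∀ n, MeasurableSet (Xs n)) (hXsmono : Monotone Xs)
    (hXs0 : (Xs 0).Nonempty)
    -- Assumption (M): minorization on each 𝒳ₙ
    (α : ℕ → ℝ) (hα : ∀ n, α n ∈ Set.Ioc (0:ℝ) 1) (hαanti : Antitone α)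
    (ν : ℕ → Measure 𝒳) (hν : ∀ n, IsProbabilityMeasure (ν n))
    (hminor : ∀ n, ∀ x ∈ Xs n, ∀ A : Set 𝒳, MeasurableSet A →
      ENNReal.ofReal (α n) * ν n A ≤ Q x A)
    -- U = (U¹,U²) uniform on [0,1]²
    {Ω : Type*} [MeasurableSpace Ω] (P : Measure Ω) [IsProbabilityMeasure P]
    (U : Ω → ℝ × ℝ) (hU : Measurable U)
    (hUlaw : Measure.map U P =
      (volume.restrict (Set.Icc (0:ℝ) 1)).prod (volume.restrict (Set.Icc (0:ℝ) 1))) :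
    ∀ n : ℕ, ∃ T : (ℝ × ℝ) × 𝒳 → 𝒳, Measurable T ∧
      (∀ x : 𝒳, ∀ A : Set 𝒳, MeasurableSet A → Q x A = P {ω | T (U ω, x) ∈ A}) ∧
      (∀ u₁ ∈ Set.Icc 0 (α n), ∀ u₂ ∈ Set.Icc (0:ℝ) 1, ∀ x₁ ∈ Xs n, ∀ x₂ ∈ Xs n,
        T ((u₁, u₂), x₁) = T ((u₁, u₂), x₂)) := by
  classical
  intro n
  have : Nonempty 𝒳 := ⟨hXs0.some⟩
  have := hν n
  have ha : α n ∈ Set.Icc (0:ℝ) 1 := Set.Ioc_subset_Icc_self (hα n)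
  have hQ : ∀ x ∈ Xs n, ENNReal.ofReal (α n) • ν n ≤ Q x := fun x hx ↦
    Measure.le_iff.2 fun A hA ↦ by simpa using hminor n x hx A hA
  obtain ⟨R, hR, hR_mem, hR_notMem⟩ :=
    Q.exists_residual (hXsmeas n) (ENNReal.ofReal_le_one.2 ha.2) (ν n) hQ
  obtain ⟨f, hf, hf_map⟩ := R.exists_measurable_map_restrict_Icc_eq
  obtain ⟨g, hg, hg_map⟩ := (Kernel.const Unit (ν n)).exists_measurable_map_restrict_Icc_eq
  have hg' : Measurable (g ()) := hg.of_uncurry_left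
  let T : (ℝ × ℝ) × 𝒳 → 𝒳 := fun p ↦
    if p.2 ∈ Xs n ∧ p.1.1 ≤ α n then g () p.1.2 else f p.2 p.1.2
  have hT : Measurable T := by
    refine Measurable.ite ?_ (by fun_prop) (by fun_prop)
    exact (measurable_snd (hXsmeas n)).inter
      (measurableSet_le (measurable_fst.comp measurable_fst) measurable_const)
  refine ⟨T, hT, fun x A hA ↦ ?_, fun u₁ hu₁ u₂ _ x₁ hx₁ x₂ hx₂ ↦ ?_⟩
  · have hTx : Measurable fun u ↦ T (u, x) := by fun_prop
    have hlaw : (P.map U).map (fun u ↦ T (u, x)) = Q x := by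
      rw [hUlaw]
      by_cases hx : x ∈ Xs n
      · simp only [T, hx, true_and]
        rw [Measure.map_prod_ite_le ha _ hg' hf.of_uncurry_left, hf_map, hg_map,
          Kernel.const_apply, ← hR_mem x hx]
      · have hcomp : (fun u ↦ T (u, x)) = f x ∘ Prod.snd := by
          ext u
          simp [T, hx]
        rw [hcomp, ← Measure.map_map hf.of_uncurry_left measurable_snd, Measure.map_snd_prod]
        simp [hf_map, hR_notMem x hx]
    rw [← hlaw, Measure.map_map hTx hU, Measure.map_apply (hTx.comp hU) hA]
    rfl
  · simp [T, hx₁, hx₂, hu₁.2]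
end

section
/- Let Assumption (M') hold, suppose P(Y_0 ∉ 𝒴_n) → 0 as n → ∞, and let (X_t) be a Markov chain in the random environment (Y_t) with kernel Q whose initial law L(X_0, (Y_k)_{k∈ℤ}) lies in 𝔐_b. Then there exists a probability measure μ♯ on 𝒳 × 𝒴^ℤ such that ‖L(X_t, (Y_{t+k})_{k∈ℤ}) − μ♯‖_TV → 0 as t → ∞. -/
open MeasureTheory ProbabilityTheory Filter

/-- `X` is a Markov chain in the random environment `Y` with kernel `Q`:
`P(X_{t+1} ∈ A | σ(Y_j, j ∈ ℤ; X_j, 0 ≤ j ≤ t)) = Q(X_t, Y_t, A)` a.s. -/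
def IsMCRE {𝒳 𝒴 Ω : Type*} [MeasurableSpace 𝒳] [MeasurableSpace 𝒴] [MeasurableSpace Ω]
    (P : Measure Ω) (Q : Kernel (𝒳 × 𝒴) 𝒳) (Y : ℤ → Ω → 𝒴) (X : ℕ → Ω → 𝒳) : Prop :=
  ∀ t : ℕ, ∀ A : Set 𝒳, MeasurableSet A →
    (P[fun ω => A.indicator (fun _ => (1:ℝ)) (X (t + 1) ω) |
        (⨆ j : ℤ, MeasurableSpace.comap (Y j) inferInstance) ⊔
          (⨆ j : Fin (t + 1), MeasurableSpace.comap (X j) inferInstance)])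
      =ᵐ[P] fun ω => ((Q (X t ω, Y t ω)) A).toReal

/-- Setwise closeness of two probability measures controls their total variation distance. -/
lemma tvDist_le_of_forall_abs_measureReal_sub_le {Z : Type*} [MeasurableSpace Z]
    {μ ν : Measure Z} [IsProbabilityMeasure μ] [IsProbabilityMeasure ν] {ε : ℝ}
    (h : ∀ A, MeasurableSet A → |μ.real A - ν.real A| ≤ ε) : tvDist μ ν ≤ 2 * ε := by
  have : Nonempty {φ : Z → ℝ // Measurable φ ∧ ∀ x, |φ x| ≤ 1} :=
    ⟨⟨fun _ => 0, measurable_const, fun _ => by simp⟩⟩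
  refine ciSup_le fun φ => ?_
  obtain ⟨φ, hφ, hb⟩ := φ
  have hint : ∀ ρ : Measure Z, IsProbabilityMeasure ρ → Integrable φ ρ := fun ρ _ =>
    Integrable.of_bound hφ.aestronglyMeasurable 1 (.of_forall hb)
  have key : ∀ ρ : Measure Z, IsProbabilityMeasure ρ →
      ∫ x, φ x ∂ρ = (∫ t in Set.Ioc (0 : ℝ) 2, ρ.real {a | t ≤ φ a + 1}) - 1 ∧
      IntegrableOn (fun t : ℝ => ρ.real {a | t ≤ φ a + 1}) (Set.Ioc 0 2) := by
    intro ρ hρ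
    constructor
    · have hlc := ((hint ρ hρ).add (integrable_const (1 : ℝ))).integral_eq_integral_Ioc_meas_le
        (M := 2) (.of_forall fun x => by have := abs_le.1 (hb x); simp; linarith)
        (.of_forall fun x => by have := abs_le.1 (hb x); simp; linarith)
      simp only [Pi.add_apply] at hlc
      rw [← hlc, integral_add (hint ρ hρ) (integrable_const 1)]
      simp
    · have hanti : Antitone fun t : ℝ => ρ.real {a | t ≤ φ a + 1} := fun s t hst =>
        measureReal_mono fun a (ha : t ≤ φ a + 1) => hst.trans ha
      exact (hanti.antitoneOn (Set.Icc 0 2)).integrableOn_isCompact isCompact_Icc |>.mono_set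
        Set.Ioc_subset_Icc_self
  obtain ⟨h1, i1⟩ := key μ inferInstance
  obtain ⟨h2, i2⟩ := key ν inferInstance
  rw [h1, h2, sub_sub_sub_cancel_right, ← integral_sub i1 i2, ← Real.norm_eq_abs]
  refine (norm_setIntegral_le_of_norm_le_const (C := ε) (by simp) fun t _ => ?_).trans ?_
  · exact h _ (measurableSet_le measurable_const (hφ.add_const 1))
  · simp [mul_comm]

/-- A sequence of probability measures that is Cauchy uniformly over measurable sets converges
uniformly over measurable sets. -/
lemma exists_isProbabilityMeasure_of_cauchy {Z : Type*} [MeasurableSpace Z]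
    (μ : ℕ → Measure Z) [∀ t, IsProbabilityMeasure (μ t)]
    (h : ∀ ε > 0, ∃ T, ∀ t ≥ T, ∀ s, ∀ A, MeasurableSet A →
      |(μ t).real A - (μ (t + s)).real A| ≤ ε) :
    ∃ μ' : Measure Z, IsProbabilityMeasure μ' ∧ ∀ ε > 0, ∃ T, ∀ t ≥ T, ∀ A, MeasurableSet A →
      |(μ t).real A - μ'.real A| ≤ ε := by
  have hlim : ∀ A, MeasurableSet A → ∃ l, Tendsto (fun t => (μ t).real A) atTop (nhds l) := by
    intro A hA
    refine cauchySeq_tendsto_of_complete (Metric.cauchySeq_iff'.2 fun ε hε => ?_)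
    obtain ⟨T, hT⟩ := h (ε / 2) (half_pos hε)
    refine ⟨T, fun n hn => ?_⟩
    obtain ⟨s, rfl⟩ := Nat.exists_eq_add_of_le hn
    rw [dist_comm, Real.dist_eq]
    linarith [hT T le_rfl s A hA]
  choose! L hL using hlim
  have hunif : ∀ ε > 0, ∃ T, ∀ t ≥ T, ∀ A, MeasurableSet A → |(μ t).real A - L A| ≤ ε := by
    intro ε hε
    obtain ⟨T, hT⟩ := h ε hε
    refine ⟨T, fun t ht A hA => le_of_tendsto (((((hL A hA).comp
      (tendsto_add_atTop_nat t)).const_sub ((μ t).real A))).abs) (.of_forall fun s => ?_)⟩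
    have := hT t ht s A hA
    rwa [add_comm] at this
  have hnn : ∀ A, MeasurableSet A → 0 ≤ L A := fun A hA =>
    ge_of_tendsto' (hL A hA) fun _ => measureReal_nonneg
  have hsum : ∀ f : ℕ → Set Z, (∀ i, MeasurableSet (f i)) → Pairwise (Function.onFun Disjoint f) →
      HasSum (fun i => L (f i)) (L (⋃ i, f i)) := by
    intro f hf hd
    have hfin : ∀ s : Finset ℕ, ∀ ρ : Measure Z, IsProbabilityMeasure ρ →
        ∑ i ∈ s, ρ.real (f i) = ρ.real (⋃ i ∈ s, f i) := fun s ρ _ =>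
      (measureReal_biUnion_finset (fun i _ j _ hij => hd hij) fun i _ => hf i).symm
    have hLfin : ∀ s : Finset ℕ, ∑ i ∈ s, L (f i) = L (⋃ i ∈ s, f i) := fun s =>
      tendsto_nhds_unique (tendsto_finsetSum s fun i _ => hL _ (hf i))
        (by simpa only [hfin s (μ _) inferInstance] using
          hL _ (Finset.measurableSet_biUnion s fun i _ => hf i))
    refine TendstoUniformly.tendsto_of_eventually_tendsto (p := atTop)
      (F := fun t s => ∑ i ∈ s, (μ t).real (f i)) ?_
      (.of_forall fun t => ?_) (hL _ (MeasurableSet.iUnion hf))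
    · rw [Metric.tendstoUniformly_iff]
      intro ε hε
      obtain ⟨T, hT⟩ := hunif (ε / 2) (half_pos hε)
      filter_upwards [eventually_ge_atTop T] with t ht s
      rw [dist_comm, Real.dist_eq, hfin s _ inferInstance]
      have := hT t ht _ (Finset.measurableSet_biUnion s fun i _ => hf i)
      rw [← hLfin] at this
      linarith
    · have hs : HasSum (fun i => (μ t).real (f i)) ((μ t).real (⋃ i, f i)) := by
        have htop := measure_ne_top (μ t) (⋃ i, f i)
        rw [Measure.real]
        rw [measure_iUnion hd hf] at htop ⊢
        rw [ENNReal.tsum_toReal_eq (ENNReal.ne_top_of_tsum_ne_top htop)]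
        exact ENNReal.hasSum_toReal htop
      exact hs
  have hempty : L ∅ = 0 :=
    tendsto_nhds_unique (hL ∅ .empty) (by simp)
  have huniv : L Set.univ = 1 :=
    tendsto_nhds_unique (hL _ .univ) (by simp)
  let μ' : Measure Z := Measure.ofMeasurable (fun A _ => ENNReal.ofReal (L A)) (by simp [hempty])
    (fun f hf hd => by
      rw [← (hsum f hf hd).tsum_eq,
        ENNReal.ofReal_tsum_of_nonneg (fun i => hnn _ (hf i)) (hsum f hf hd).summable])
  have hμ' : ∀ A, MeasurableSet A → μ' A = ENNReal.ofReal (L A) := fun A hA =>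
    Measure.ofMeasurable_apply A hA
  refine ⟨μ', ⟨by simp [hμ' _ .univ, huniv]⟩, fun ε hε => ?_⟩
  obtain ⟨T, hT⟩ := hunif ε hε
  refine ⟨T, fun t ht A hA => ?_⟩
  rw [Measure.real, Measure.real, hμ' A hA, ENNReal.toReal_ofReal (hnn A hA)]
  exact hT t ht A hA

/-- Two finite measures on a product with the same second marginal share a large part of the
second marginals of their restrictions to a set on which both carry almost all their mass. -/
lemma exists_le_snd_restrict {𝒳 E : Type*} [MeasurableSpace 𝒳] [MeasurableSpace E]
    (a b : Measure (𝒳 × E)) [IsFiniteMeasure a] [IsFiniteMeasure b] (hab : a.snd = b.snd)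
    (G : Set (𝒳 × E)) :
    ∃ σ : Measure E, σ ≤ (a.restrict G).snd ∧ σ ≤ (b.restrict G).snd ∧
      a Set.univ ≤ σ Set.univ + (a Gᶜ + b Gᶜ) := by
  obtain ⟨s, hs⟩ := exists_isHahnDecomposition (a.restrict G).snd (b.restrict G).snd
  have hsm := hs.measurableSet
  have hsplit : ∀ (c : Measure (𝒳 × E)) {u : Set E}, MeasurableSet u →
      c.snd u ≤ (c.restrict G).snd u + c Gᶜ := by
    intro c u hu
    rw [Measure.snd_apply hu, Measure.snd_apply hu, Measure.restrict_apply (measurable_snd hu)]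
    calc c (Prod.snd ⁻¹' u) ≤ c ((Prod.snd ⁻¹' u ∩ G) ∪ Gᶜ) :=
          measure_mono fun z hz => by by_cases h : z ∈ G <;> simp_all
      _ ≤ _ := measure_union_le _ _
  refine ⟨(a.restrict G).snd.restrict s + (b.restrict G).snd.restrict sᶜ, ?_, ?_, ?_⟩
  · calc _ ≤ (a.restrict G).snd.restrict s + (a.restrict G).snd.restrict sᶜ := by
          exact add_le_add le_rfl hs.ge_on_compl
      _ = _ := Measure.restrict_add_restrict_compl hsm
  · calc _ ≤ (b.restrict G).snd.restrict s + (b.restrict G).snd.restrict sᶜ := by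
          exact add_le_add hs.le_on le_rfl
      _ = _ := Measure.restrict_add_restrict_compl hsm
  · calc a Set.univ = a.snd s + a.snd sᶜ := by
          rw [measure_add_measure_compl hsm, Measure.snd_univ]
      _ ≤ ((a.restrict G).snd s + a Gᶜ) + ((b.restrict G).snd sᶜ + b Gᶜ) := by
          gcongr
          · exact hsplit a hsm
          · rw [hab]; exact hsplit b hsm.compl
      _ = _ := by simp; ring

/-- A minorization of `R` by a kernel `S` depending on the second coordinate only passes to
the measures obtained by composition. -/
lemma smul_comp_le_comp {𝒳 E F : Type*} [MeasurableSpace 𝒳] [MeasurableSpace E]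
    [MeasurableSpace F] (R : Kernel (𝒳 × E) F) (S : Kernel E F) {G : Set (𝒳 × E)}
    {r : ENNReal} (hRS : ∀ z ∈ G, r • S z.2 ≤ R z)
    {a : Measure (𝒳 × E)} {σ : Measure E} (hσ : σ ≤ (a.restrict G).snd) :
    r • (S ∘ₘ σ) ≤ R ∘ₘ a := by
  refine Measure.le_iff.2 fun A hA => ?_
  have hm : Measurable fun z : 𝒳 × E => S z.2 A := (S.measurable_coe hA).comp measurable_snd
  calc (r • (S ∘ₘ σ)) A = r * ∫⁻ y, S y A ∂σ := by
        simp [Measure.bind_apply hA S.aemeasurable]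
    _ ≤ r * ∫⁻ y, S y A ∂(a.restrict G).snd := by gcongr
    _ = ∫⁻ z in G, r * S z.2 A ∂a := by
        rw [Measure.snd, lintegral_map (S.measurable_coe hA) measurable_snd,
          lintegral_const_mul _ hm]
    _ ≤ ∫⁻ z in G, R z A ∂a := setLIntegral_mono (R.measurable_coe hA) fun z hz => hRS z hz A
    _ ≤ ∫⁻ z, R z A ∂a := setLIntegral_le_lintegral _ _
    _ = _ := (Measure.bind_apply hA R.aemeasurable).symm

lemma eq_of_add_eq_add_left {Z : Type*} [MeasurableSpace Z] {c a b : Measure Z}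
    [IsFiniteMeasure c] (h : c + a = c + b) : a = b := by
  ext A hA
  have := congrArg (fun m : Measure Z => m A) h
  simpa [ENNReal.add_right_inj (measure_ne_top c A)] using this

/-- Evolving two laws with a common second marginal under a kernel that satisfies a minorization
on `G` makes the mass of their non-common parts decay geometrically, up to twice the mass that
the laws give to the complement of `G`. -/
lemma exists_common_part {𝒳 E : Type*} [MeasurableSpace 𝒳] [MeasurableSpace E]
    (R : Kernel (𝒳 × E) (𝒳 × E)) [IsMarkovKernel R] (S : Kernel E (𝒳 × E)) [IsMarkovKernel S]
    {G : Set (𝒳 × E)} {r : ℝ} (hr : r ∈ Set.Ioc (0 : ℝ) 1)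
    (hRS : ∀ z ∈ G, ENNReal.ofReal r • S z.2 ≤ R z)
    (μ ρ : ℕ → Measure (𝒳 × E)) [∀ t, IsProbabilityMeasure (μ t)]
    [∀ t, IsProbabilityMeasure (ρ t)]
    (hμ : ∀ t, μ (t + 1) = R ∘ₘ μ t) (hρ : ∀ t, ρ (t + 1) = R ∘ₘ ρ t)
    (hsnd : ∀ t, (μ t).snd = (ρ t).snd) {δ : ℝ} (hδ : 0 ≤ δ)
    (hμG : ∀ t, (μ t).real Gᶜ ≤ δ) (hρG : ∀ t, (ρ t).real Gᶜ ≤ δ) (t : ℕ) :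
    ∃ c a b : Measure (𝒳 × E), μ t = c + a ∧ ρ t = c + b ∧
      a.real Set.univ ≤ 2 * δ + (1 - r) ^ t := by
  induction t with
  | zero => exact ⟨0, μ 0, ρ 0, by simp, by simp, by simp; linarith⟩
  | succ t ih =>
    obtain ⟨c, a, b, hc, hb, hm⟩ := ih
    have hcμ : c ≤ μ t := hc ▸ Measure.le_add_right le_rfl
    have haμ : a ≤ μ t := hc ▸ Measure.le_add_left le_rfl
    have hbρ : b ≤ ρ t := hb ▸ Measure.le_add_left le_rfl
    have : IsFiniteMeasure c := isFiniteMeasure_of_le _ hcμ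
    have : IsFiniteMeasure a := isFiniteMeasure_of_le _ haμ
    have : IsFiniteMeasure b := isFiniteMeasure_of_le _ hbρ
    have hab : a.snd = b.snd := by
      refine eq_of_add_eq_add_left (c := c.snd) ?_
      rw [← Measure.snd_add, ← Measure.snd_add, ← hc, ← hb, hsnd]
    obtain ⟨σ, hσa, hσb, hσ⟩ := exists_le_snd_restrict a b hab G
    have : IsFiniteMeasure σ := isFiniteMeasure_of_le _ hσa
    set e : Measure (𝒳 × E) := ENNReal.ofReal r • (S ∘ₘ σ) with he
    have hea : e ≤ R ∘ₘ a := smul_comp_le_comp R S hRS hσa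
    have heb : e ≤ R ∘ₘ b := smul_comp_le_comp R S hRS hσb
    have : IsFiniteMeasure e := isFiniteMeasure_of_le _ hea
    refine ⟨R ∘ₘ c + e, R ∘ₘ a - e, R ∘ₘ b - e, ?_, ?_, ?_⟩
    · rw [add_assoc, add_comm e, Measure.sub_add_cancel_of_le hea, hμ, hc, Measure.comp_add]
    · rw [add_assoc, add_comm e, Measure.sub_add_cancel_of_le heb, hρ, hb, Measure.comp_add]
    · have hemass : e.real Set.univ = r * σ.real Set.univ := by
        simp [he, Measure.real, Measure.comp_apply_univ, ENNReal.toReal_ofReal hr.1.le]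
      have hmass : (R ∘ₘ a - e).real Set.univ + e.real Set.univ = a.real Set.univ := by
        rw [← measureReal_add_apply, Measure.sub_add_cancel_of_le hea]
        simp [Measure.real, Measure.comp_apply_univ]
      have hσ' : a.real Set.univ ≤ σ.real Set.univ + (a.real Gᶜ + b.real Gᶜ) := by
        have := ENNReal.toReal_mono (by finiteness) hσ
        rwa [ENNReal.toReal_add (by finiteness) (by finiteness),
          ENNReal.toReal_add (by finiteness) (by finiteness)] at this
      have h1 : a.real Gᶜ ≤ δ :=
        (ENNReal.toReal_mono (by finiteness) (haμ _)).trans (hμG t)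
      have h2 : b.real Gᶜ ≤ δ :=
        (ENNReal.toReal_mono (by finiteness) (hbρ _)).trans (hρG t)
      have h3 : r * (a.real Set.univ - 2 * δ) ≤ r * σ.real Set.univ :=
        mul_le_mul_of_nonneg_left (by linarith) hr.1.le
      have h4 : (1 - r) * (a.real Set.univ - 2 * δ) ≤ (1 - r) * (1 - r) ^ t :=
        mul_le_mul_of_nonneg_left (by linarith) (by linarith [hr.2])
      rw [pow_succ']
      nlinarith

lemma abs_measureReal_sub_le_of_common_part {Z : Type*} [MeasurableSpace Z]
    {μ ρ c a b : Measure Z} [IsProbabilityMeasure μ] [IsProbabilityMeasure ρ]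
    (hμ : μ = c + a) (hρ : ρ = c + b) (A : Set Z) : |μ.real A - ρ.real A| ≤ a.real Set.univ := by
  have : IsFiniteMeasure c := isFiniteMeasure_of_le μ (hμ ▸ Measure.le_add_right le_rfl)
  have : IsFiniteMeasure a := isFiniteMeasure_of_le μ (hμ ▸ Measure.le_add_left le_rfl)
  have : IsFiniteMeasure b := isFiniteMeasure_of_le ρ (hρ ▸ Measure.le_add_left le_rfl)
  have h : ∀ A, μ.real A = c.real A + a.real A := fun A => by rw [hμ, measureReal_add_apply]
  have h' : ∀ A, ρ.real A = c.real A + b.real A := fun A => by rw [hρ, measureReal_add_apply]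
  have hu := h Set.univ
  have hu' := h' Set.univ
  rw [probReal_univ] at hu hu'
  have h1 := measureReal_mono (μ := a) (Set.subset_univ A)
  have h2 := measureReal_mono (μ := b) (Set.subset_univ A)
  have h3 : 0 ≤ a.real A := measureReal_nonneg
  have h4 : 0 ≤ b.real A := measureReal_nonneg
  rw [h, h', abs_le]
  constructor <;> linarith

/-- The transition kernel of the chain coupled with the environment seen from the current time. -/
noncomputable def envKernel {𝒳 𝒴 : Type*} [MeasurableSpace 𝒳] [MeasurableSpace 𝒴]
    (Q : Kernel (𝒳 × 𝒴) 𝒳) : Kernel (𝒳 × (ℤ → 𝒴)) (𝒳 × (ℤ → 𝒴)) :=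
  (Q.comap (fun z : 𝒳 × (ℤ → 𝒴) => (z.1, z.2 0)) (by fun_prop)) ×ₖ
    Kernel.deterministic (fun (z : 𝒳 × (ℤ → 𝒴)) (k : ℤ) => z.2 (k + 1)) (by fun_prop)

instance {𝒳 𝒴 : Type*} [MeasurableSpace 𝒳] [MeasurableSpace 𝒴]
    (Q : Kernel (𝒳 × 𝒴) 𝒳) [IsMarkovKernel Q] : IsMarkovKernel (envKernel Q) := by
  unfold envKernel; infer_instance

lemma envKernel_apply {𝒳 𝒴 : Type*} [MeasurableSpace 𝒳] [MeasurableSpace 𝒴]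
    (Q : Kernel (𝒳 × 𝒴) 𝒳) [IsMarkovKernel Q] (z : 𝒳 × (ℤ → 𝒴)) :
    envKernel Q z = (Q (z.1, z.2 0)).prod (Measure.dirac fun k => z.2 (k + 1)) := by
  rw [envKernel, Kernel.prod_apply, Kernel.comap_apply, Kernel.deterministic_apply]

lemma measureReal_inter_eq_setIntegral_of_condExp {Ω : Type*} {m mΩ : MeasurableSpace Ω}
    {P : Measure Ω} [IsFiniteMeasure P] (hm : m ≤ mΩ) {A D : Set Ω} (hA : MeasurableSet A)
    (hD : MeasurableSet[m] D) {f : Ω → ℝ} (h : P[A.indicator fun _ => (1 : ℝ) | m] =ᵐ[P] f) :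
    P.real (A ∩ D) = ∫ ω in D, f ω ∂P := by
  rw [← setIntegral_congr_ae (hm _ hD) (h.mono fun ω hω _ => hω),
    setIntegral_condExp hm ((integrable_const (1 : ℝ)).indicator hA) hD,
    integral_indicator_const _ hA, measureReal_restrict_apply hA]
  simp

/-- The law of the chain together with the environment seen from the current time evolves under
`envKernel`. -/
lemma IsMCRE.map_succ {𝒳 𝒴 Ω : Type*} [MeasurableSpace 𝒳] [MeasurableSpace 𝒴]
    [MeasurableSpace Ω] {P : Measure Ω} [IsProbabilityMeasure P] {Q : Kernel (𝒳 × 𝒴) 𝒳}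
    [IsMarkovKernel Q] {Y : ℤ → Ω → 𝒴} {X : ℕ → Ω → 𝒳} (h : IsMCRE P Q Y X)
    (hY : ∀ j, Measurable (Y j)) (hX : ∀ t, Measurable (X t)) (t : ℕ) :
    P.map (fun ω => (X (t + 1) ω, fun k : ℤ => Y (((t + 1 : ℕ) : ℤ) + k) ω)) =
      envKernel Q ∘ₘ P.map (fun ω => (X t ω, fun k : ℤ => Y ((t : ℤ) + k) ω)) := by
  have hm : ∀ t : ℕ, Measurable fun ω => (X t ω, fun k : ℤ => Y ((t : ℤ) + k) ω) := fun t =>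
    (hX t).prodMk (measurable_pi_lambda _ fun k => hY _)
  have := Measure.isProbabilityMeasure_map (μ := P) (hm t).aemeasurable
  have := Measure.isProbabilityMeasure_map (μ := P) (hm (t + 1)).aemeasurable
  refine Measure.ext_prod fun {A B} hA hB => ?_
  set D : Set Ω := (fun ω => fun k : ℤ => Y (((t + 1 : ℕ) : ℤ) + k) ω) ⁻¹' B
  have hDm : MeasurableSet D := (measurable_pi_lambda _ fun k => hY _) hB
  have hQm : Measurable fun ω => Q (X t ω, Y t ω) A :=
    (Q.measurable_coe hA).comp ((hX t).prodMk (hY t))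
  have hce : P.real (X (t + 1) ⁻¹' A ∩ D) = ∫ ω in D, (Q (X t ω, Y t ω) A).toReal ∂P := by
    refine measureReal_inter_eq_setIntegral_of_condExp
      (sup_le (iSup_le fun j => (hY j).comap_le) (iSup_le fun j : Fin (t + 1) => (hX j).comap_le))
      (hX (t + 1) hA) ?_ (h t A hA)
    refine @measurable_pi_lambda Ω ℤ (fun _ => 𝒴) (_) _ _ (fun k => ?_) _ hB
    exact Measurable.of_comap_le
      (le_sup_of_le_left (le_iSup (fun j => MeasurableSpace.comap (Y j) inferInstance) _))
  have hl : P (X (t + 1) ⁻¹' A ∩ D) = ∫⁻ ω in D, Q (X t ω, Y t ω) A ∂P := by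
    rw [integral_toReal hQm.aemeasurable (.of_forall fun ω => measure_lt_top _ _)] at hce
    refine (ENNReal.toReal_eq_toReal_iff' (measure_ne_top _ _) ?_).1 hce
    refine ((lintegral_mono fun ω => prob_le_one).trans_lt ?_).ne (b := ⊤)
    simp
  rw [Measure.map_apply (hm _) (hA.prod hB),
    Measure.bind_apply (hA.prod hB) (Kernel.aemeasurable _),
    lintegral_map (Kernel.measurable_coe _ (hA.prod hB)) (hm t)]
  change P (X (t + 1) ⁻¹' A ∩ D) = _
  rw [hl, ← lintegral_indicator hDm]
  refine lintegral_congr fun ω => ?_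
  rw [envKernel_apply, Measure.prod_prod, Measure.dirac_apply' _ hB]
  have hs : (fun k : ℤ => Y ((t : ℤ) + (k + 1)) ω) = fun k : ℤ => Y (((t + 1 : ℕ) : ℤ) + k) ω := by
    funext k; congr 1; push_cast; ring
  simp only [hs, add_zero]
  by_cases hω : ω ∈ D
  · have hB' : (fun k : ℤ => Y (((t + 1 : ℕ) : ℤ) + k) ω) ∈ B := hω
    rw [Set.indicator_of_mem hω, Set.indicator_of_mem hB', Pi.one_apply, mul_one]
  · have hB' : (fun k : ℤ => Y (((t + 1 : ℕ) : ℤ) + k) ω) ∉ B := hω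
    rw [Set.indicator_of_notMem hω, Set.indicator_of_notMem hB', mul_zero]

theorem mcre_convergence
    {𝒳 𝒴 : Type*} [MeasurableSpace 𝒳] [TopologicalSpace 𝒳] [PolishSpace 𝒳] [BorelSpace 𝒳]
    [MeasurableSpace 𝒴] [TopologicalSpace 𝒴] [PolishSpace 𝒴] [BorelSpace 𝒴]
    {Ω : Type*} [MeasurableSpace Ω] (P : Measure Ω) [IsProbabilityMeasure P]
    -- stationary environment
    (Y : ℤ → Ω → 𝒴) (hYmeas : ∀ j, Measurable (Y j))
    (hYstat : ∀ k : ℤ, Measure.map (fun ω => fun j : ℤ => Y (j + k) ω) P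
      = Measure.map (fun ω => fun j : ℤ => Y j ω) P)
    -- parametrized family of transition kernels
    (Q : Kernel (𝒳 × 𝒴) 𝒳) [IsMarkovKernel Q]
    (Xs : ℕ → Set 𝒳) (hXsmeas : ∀ n, MeasurableSet (Xs n)) (hXsmono : Monotone Xs)
    (hXs0 : (Xs 0).Nonempty)
    (Ys : ℕ → Set 𝒴) (hYsmeas : ∀ n, MeasurableSet (Ys n)) (hYsmono : Monotone Ys)
    (hYs0 : (Ys 0).Nonempty)
    -- Assumption (M')
    (α : ℕ → ℝ) (hα : ∀ n, α n ∈ Set.Ioc (0:ℝ) 1) (hαanti : Antitone α)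
    (ν : ℕ → Measure 𝒳) (hν : ∀ n, IsProbabilityMeasure (ν n))
    (hminor : ∀ n, ∀ x ∈ Xs n, ∀ y ∈ Ys n, ∀ A : Set 𝒳, MeasurableSet A →
      ENNReal.ofReal (α n) * ν n A ≤ Q (x, y) A)
    -- P(Y₀ ∉ 𝒴ₙ) → 0
    (hY0 : Tendsto (fun n => P {ω | Y 0 ω ∉ Ys n}) atTop (nhds 0))
    -- the chain
    (X : ℕ → Ω → 𝒳) (hXmeas : ∀ t, Measurable (X t))
    (hmcre : IsMCRE P Q Y X)
    -- initial law in 𝔐_b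
    (htight : Tendsto (fun n => ⨆ t, P {ω | X t ω ∉ Xs n}) atTop (nhds 0)) :
    ∃ μsharp : Measure (𝒳 × (ℤ → 𝒴)), IsProbabilityMeasure μsharp ∧
      Tendsto (fun t : ℕ =>
          tvDist (Measure.map (fun ω => (X t ω, fun k : ℤ => Y ((t : ℤ) + k) ω)) P) μsharp)
        atTop (nhds 0) := by
  have hm : ∀ t : ℕ, Measurable fun ω => (X t ω, fun k : ℤ => Y ((t : ℤ) + k) ω) := fun t =>
    (hXmeas t).prodMk (measurable_pi_lambda _ fun k => hYmeas _)
  let μ : ℕ → Measure (𝒳 × (ℤ → 𝒴)) := fun t =>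
    P.map fun ω => (X t ω, fun k : ℤ => Y ((t : ℤ) + k) ω)
  have hμprob : ∀ t, IsProbabilityMeasure (μ t) := fun t =>
    Measure.isProbabilityMeasure_map (hm t).aemeasurable
  have hμsnd : ∀ t, (μ t).snd = P.map fun ω => fun j : ℤ => Y j ω := by
    intro t
    rw [Measure.snd, Measure.map_map measurable_snd (hm t), ← hYstat t]
    congr 1
    funext ω k
    simp [add_comm]
  have hμsucc : ∀ t, μ (t + 1) = envKernel Q ∘ₘ μ t := hmcre.map_succ hYmeas hXmeas
  have hYt : ∀ (t : ℕ) n, P {ω | Y t ω ∉ Ys n} = P {ω | Y 0 ω ∉ Ys n} := by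
    intro t n
    have hB : MeasurableSet {y : ℤ → 𝒴 | y 0 ∉ Ys n} := 
      measurable_pi_apply (X := fun _ : ℤ => 𝒴) 0 (hYsmeas n).compl
    have := congrArg (fun m : Measure (ℤ → 𝒴) => m {y | y 0 ∉ Ys n}) (hYstat t)
    rw [Measure.map_apply (measurable_pi_lambda _ fun k => hYmeas _) hB,
      Measure.map_apply (measurable_pi_lambda _ fun k => hYmeas _) hB] at this
    simpa using this
  have hcauchy : ∀ ε > 0, ∃ T, ∀ t ≥ T, ∀ s, ∀ A, MeasurableSet A →
      |(μ t).real A - (μ (t + s)).real A| ≤ ε := by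
    intro ε hε
    have hε8 : (0 : ENNReal) < ENNReal.ofReal (ε / 8) := by simpa using hε
    obtain ⟨n, hn1, hn2⟩ := ((hY0.eventually_le_const hε8).and
      (htight.eventually_le_const hε8)).exists
    let G : Set (𝒳 × (ℤ → 𝒴)) := {z | z.1 ∈ Xs n ∧ z.2 0 ∈ Ys n}
    have hG : MeasurableSet G := (measurable_fst (hXsmeas n)).inter
      (((measurable_pi_apply 0).comp measurable_snd) (hYsmeas n))
    have hμG : ∀ t, (μ t).real Gᶜ ≤ ε / 4 := by
      intro t
      refine ENNReal.toReal_le_of_le_ofReal (by positivity) ?_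
      rw [Measure.map_apply (hm t) hG.compl]
      calc P _ ≤ P ({ω | X t ω ∉ Xs n} ∪ {ω | Y t ω ∉ Ys n}) :=
            measure_mono fun ω hω => by
              have : ¬ (X t ω ∈ Xs n ∧ Y t ω ∈ Ys n) := by simpa [G] using hω
              exact not_and_or.1 this
        _ ≤ P {ω | X t ω ∉ Xs n} + P {ω | Y t ω ∉ Ys n} := measure_union_le _ _
        _ ≤ ENNReal.ofReal (ε / 8) + ENNReal.ofReal (ε / 8) := by
            rw [hYt]
            exact add_le_add ((le_iSup (fun t => P {ω | X t ω ∉ Xs n}) t).trans hn2) hn1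
        _ = ENNReal.ofReal (ε / 4) := by
            rw [← ENNReal.ofReal_add (by positivity) (by positivity)]; ring_nf
    have := hν n
    let S : Kernel (ℤ → 𝒴) (𝒳 × (ℤ → 𝒴)) := Kernel.const _ (ν n) ×ₖ
      Kernel.deterministic (fun (y : ℤ → 𝒴) (k : ℤ) => y (k + 1)) (by fun_prop)
    have hRS : ∀ z ∈ G, ENNReal.ofReal (α n) • S z.2 ≤ envKernel Q z := by
      rintro z ⟨hz1, hz2⟩
      rw [envKernel_apply, Kernel.prod_apply, Kernel.const_apply, Kernel.deterministic_apply,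
        ← Measure.prod_smul_left]
      gcongr
      exact Measure.le_iff.2 fun A hA => by simpa using hminor n _ hz1 _ hz2 A hA
    obtain ⟨T, hT⟩ := exists_pow_lt_of_lt_one (half_pos hε) (by linarith [(hα n).1] : 1 - α n < 1)
    refine ⟨T, fun t ht s A hA => ?_⟩
    obtain ⟨c, a, b, hc, hb, hmass⟩ := exists_common_part (envKernel Q) S (hα n) hRS μ
      (fun t => μ (t + s)) hμsucc (fun t => by simp only [add_right_comm]; exact hμsucc _)
      (fun t => (hμsnd t).trans (hμsnd _).symm) (δ := ε / 4) (by positivity) hμG (fun t => hμG _) t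
    have hpow : (1 - α n) ^ t ≤ (1 - α n) ^ T :=
      pow_le_pow_of_le_one (by linarith [(hα n).2]) (by linarith [(hα n).1]) ht
    linarith [abs_measureReal_sub_le_of_common_part hc hb A]
  obtain ⟨μ', hμ', hlim⟩ := exists_isProbabilityMeasure_of_cauchy μ hcauchy
  refine ⟨μ', hμ', Metric.tendsto_atTop.2 fun ε hε => ?_⟩
  obtain ⟨T, hT⟩ := hlim (ε / 4) (by positivity)
  refine ⟨T, fun t ht => ?_⟩
  have hle : tvDist (μ t) μ' ≤ 2 * (ε / 4) := tvDist_le_of_forall_abs_measureReal_sub_le (hT t ht)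
  have hnn : 0 ≤ tvDist (μ t) μ' := Real.iSup_nonneg fun _ => abs_nonneg _
  rw [Real.dist_eq, sub_zero, abs_of_nonneg hnn]
  linarith
end

section
/- For the discrete-time stochastic volatility model whose innovation ε has a positive density f with inf_{x∈[−m,m]} f(x) = c(m) > 0 for every m ∈ ℕ, define the transition kernel Q(x, (z, e), A) = P(γx + ρ e^{z} e + √(1−ρ²) e^{z} ε ∈ A) for x ∈ ℝ and (z, e) ∈ ℝ². Then for every n ∈ ℕ there exists d(n) > 0 such that for all x ∈ [−n, n], all (z, e) with |z| ≤ n and |e| ≤ n, and all Borel A ⊆ ℝ, Q(x, (z, e), A) ≥ α_n ν_n(A), where ν_n = (1/2)·Leb restricted to [−1,1] and α_n = 2 c(d(n)) > 0. -/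
open MeasureTheory ProbabilityTheory Filter
open scoped ENNReal

/-- A measure with density `f` dominates `r • volume` on any measurable set where `r ≤ f`. -/
theorem ofReal_mul_volume_le_withDensity {f : ℝ → ℝ} {r : ℝ} {S : Set ℝ}
    (hS : MeasurableSet S) (hr : ∀ x ∈ S, r ≤ f x) :
    ENNReal.ofReal r * volume S ≤ volume.withDensity (fun x => ENNReal.ofReal (f x)) S := by
  rw [withDensity_apply _ hS, ← setLIntegral_const]
  exact setLIntegral_mono' hS fun x hx => ENNReal.ofReal_le_ofReal (hr x hx)

/-- A probability density bounded below by `r` on `[-d, d]` satisfies `2 * d * r ≤ 1`. -/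
theorem mul_two_mul_le_one_of_le_density {f : ℝ → ℝ}
    [IsProbabilityMeasure (volume.withDensity (fun x => ENNReal.ofReal (f x)))]
    {r d : ℝ} (hr0 : 0 ≤ r) (hr : ∀ x ∈ Set.Icc (-d) d, r ≤ f x) : r * (2 * d) ≤ 1 := by
  have h := (ofReal_mul_volume_le_withDensity measurableSet_Icc hr).trans prob_le_one
  rw [Real.volume_Icc, ← ENNReal.ofReal_mul hr0, ENNReal.ofReal_le_one] at h
  linarith

/-- Lebesgue measure of the preimage of a set under `u ↦ b + a * u`. -/
theorem volume_preimage_affine {a : ℝ} (ha : 0 < a) (b : ℝ) (B : Set ℝ) :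
    volume ((fun u => b + a * u) ⁻¹' B) = ENNReal.ofReal a⁻¹ * volume B := by
  have h : (fun u => b + a * u) ⁻¹' B = (fun u => a * u) ⁻¹' ((fun y => b + y) ⁻¹' B) := rfl
  rw [h, Real.volume_preimage_mul_left ha.ne', measure_preimage_add, abs_of_pos (inv_pos.2 ha)]

/-- If `ε` has a density bounded below by `r` on `[-m, m]`, then the law of `b + a * ε` dominates
`(r / a) • volume` on `[-1, 1]` as soon as `1 + |b| ≤ m * a`. -/
theorem le_map_affine_of_le_density {Ω : Type*} [MeasurableSpace Ω] {P : Measure Ω} {ε : Ω → ℝ}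
    (hε : Measurable ε) {f : ℝ → ℝ}
    (hlaw : Measure.map ε P = volume.withDensity (fun x => ENNReal.ofReal (f x)))
    {r m a b : ℝ} (hr0 : 0 ≤ r) (hr : ∀ x ∈ Set.Icc (-m) m, r ≤ f x) (ha : 0 < a)
    (hb : 1 + |b| ≤ m * a) {A : Set ℝ} (hA : MeasurableSet A) :
    ENNReal.ofReal (r * a⁻¹) * volume (A ∩ Set.Icc (-1) 1) ≤
      Measure.map (fun ω => b + a * ε ω) P A := by
  have hg : Measurable fun u : ℝ => b + a * u := by fun_prop
  have hB : MeasurableSet (A ∩ Set.Icc (-1 : ℝ) 1) := hA.inter measurableSet_Icc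
  have hsub : ∀ u ∈ (fun u => b + a * u) ⁻¹' (A ∩ Set.Icc (-1 : ℝ) 1), r ≤ f u := by
    rintro u ⟨-, h1, h2⟩
    have h3 := le_abs_self b
    have h4 := neg_abs_le b
    refine hr u ⟨le_of_mul_le_mul_right ?_ ha, le_of_mul_le_mul_right ?_ ha⟩ <;> linarith
  have hmap : Measure.map (fun ω => b + a * ε ω) P = Measure.map (fun u => b + a * u)
      (Measure.map ε P) := (Measure.map_map hg hε).symm
  calc ENNReal.ofReal (r * a⁻¹) * volume (A ∩ Set.Icc (-1) 1)
      = ENNReal.ofReal r * volume ((fun u => b + a * u) ⁻¹' (A ∩ Set.Icc (-1 : ℝ) 1)) := by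
        rw [volume_preimage_affine ha, ENNReal.ofReal_mul hr0, mul_assoc]
    _ ≤ Measure.map ε P ((fun u => b + a * u) ⁻¹' (A ∩ Set.Icc (-1 : ℝ) 1)) := by
        rw [hlaw]
        exact ofReal_mul_volume_le_withDensity (hg hB) hsub
    _ ≤ Measure.map (fun ω => b + a * ε ω) P A := by
        rw [hmap, Measure.map_apply hg hA]
        exact measure_mono (Set.preimage_mono Set.inter_subset_left)

/-- Minorization for the discrete-time stochastic volatility kernel
`Q(x,(z,e),·) = L(γx + ρ e^z e + √(1−ρ²) e^z ε)`: for every `n` there is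
`d(n) ∈ ℕ`, `d(n) > 0`, such that `Q(x,(z,e),A) ≥ α_n ν_n(A)` for all
`x ∈ [−n,n]`, `|z| ≤ n`, `|e| ≤ n`, with `ν_n = (1/2)·Leb|₍₋₁,₁₎` and
`α_n = 2 c(d(n)) > 0`, where `c(m) = inf_{[−m,m]} f`. -/
theorem discrete_vol_minorization
    {Ω : Type*} [MeasurableSpace Ω] (P : Measure Ω) [IsProbabilityMeasure P]
    (γ ρ : ℝ) (hγ : γ ∈ Set.Ioo (0:ℝ) 1) (hρ : ρ ∈ Set.Ioo (-1:ℝ) 1)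
    -- the innovation ε with a positive density f
    (ε : Ω → ℝ) (hεmeas : Measurable ε)
    (f : ℝ → ℝ) (hfpos : ∀ x, 0 < f x)
    (hεlaw : Measure.map ε P = volume.withDensity (fun x => ENNReal.ofReal (f x)))
    (c : ℕ → ℝ) (hc : ∀ m : ℕ, c m = sInf (f '' Set.Icc (-(m:ℝ)) m))
    (hcpos : ∀ m : ℕ, 0 < c m) :
    ∀ n : ℕ, ∃ d : ℕ, 0 < d ∧ 0 < c d ∧
      ∀ x ∈ Set.Icc (-(n:ℝ)) n, ∀ z e : ℝ, |z| ≤ (n:ℝ) → |e| ≤ (n:ℝ) →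
        ∀ A : Set ℝ, MeasurableSet A →
          ENNReal.ofReal (2 * c d) * ((2:ℝ≥0∞)⁻¹ • volume.restrict (Set.Icc (-1:ℝ) 1)) A ≤
            Measure.map (fun ω => γ * x + ρ * Real.exp z * e
              + Real.sqrt (1 - ρ ^ 2) * Real.exp z * ε ω) P A := by
  intro n
  have hcf : ∀ m : ℕ, ∀ x ∈ Set.Icc (-(m : ℝ)) m, c m ≤ f x := fun m x hx => by
    rw [hc]
    exact csInf_le ⟨0, by rintro _ ⟨y, -, rfl⟩; exact (hfpos y).le⟩ ⟨x, hx, rfl⟩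
  have : IsProbabilityMeasure (volume.withDensity (fun x => ENNReal.ofReal (f x))) :=
    hεlaw ▸ Measure.isProbabilityMeasure_map hεmeas.aemeasurable
  have hρ2 : 0 < 1 - ρ ^ 2 := by nlinarith [hρ.1, hρ.2]
  set s := Real.sqrt (1 - ρ ^ 2)
  have hs0 : 0 < s := Real.sqrt_pos.2 hρ2
  have hs1 : s ≤ 1 := Real.sqrt_le_one.2 (by nlinarith [sq_nonneg ρ])
  have hE : 0 < Real.exp n := Real.exp_pos _
  have hn : (0 : ℝ) ≤ n := n.cast_nonneg
  obtain ⟨m, hm⟩ := exists_nat_ge ((1 + (n + Real.exp n * n)) / (s * Real.exp (-n)))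
  rw [div_le_iff₀ (by positivity)] at hm
  -- `c d ≤ 1 / (2 * d)` forces `c d` below the lower bound of the rescaled density
  obtain ⟨d, hd⟩ := exists_nat_ge (Real.exp n / c m)
  have hd0 : (0 : ℝ) < d := (div_pos hE (hcpos m)).trans_le hd
  rw [div_le_iff₀ (hcpos m)] at hd
  have hcd : c d * Real.exp n ≤ c m := by
    have h1 := mul_two_mul_le_one_of_le_density (hcpos d).le (hcf d)
    have h2 : c d * Real.exp n ≤ c d * (d * c m) := mul_le_mul_of_nonneg_left hd (hcpos d).le
    nlinarith [hcpos m, mul_pos (hcpos d) hd0]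
  refine ⟨d, by exact_mod_cast hd0, hcpos d, fun x hx z e hz he A hA => ?_⟩
  have hzE : Real.exp z ≤ Real.exp n := Real.exp_le_exp.2 (abs_le.1 hz).2
  have ha : 0 < s * Real.exp z := mul_pos hs0 (Real.exp_pos z)
  have haE : s * Real.exp z ≤ Real.exp n :=
    (mul_le_of_le_one_left (Real.exp_pos z).le hs1).trans hzE
  have hb : |γ * x + ρ * Real.exp z * e| ≤ n + Real.exp n * n := by
    refine (abs_add_le _ _).trans (add_le_add ?_ ?_)
    · rw [abs_mul, abs_of_pos hγ.1]
      exact (mul_le_of_le_one_left (abs_nonneg x) hγ.2.le).trans (abs_le.2 hx)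
    · rw [abs_mul, abs_mul, Real.abs_exp]
      have hρ1 : |ρ| ≤ 1 := abs_le.2 ⟨hρ.1.le, hρ.2.le⟩
      exact mul_le_mul ((mul_le_of_le_one_left (Real.exp_pos z).le hρ1).trans hzE) he
        (abs_nonneg e) hE.le
  have hbm : 1 + |γ * x + ρ * Real.exp z * e| ≤ m * (s * Real.exp z) := by
    have hEz : Real.exp (-n) ≤ Real.exp z := Real.exp_le_exp.2 (abs_le.1 hz).1
    calc _ ≤ m * (s * Real.exp (-n)) := by linarith
      _ ≤ _ := by gcongr
  have hda : c d ≤ c m * (s * Real.exp z)⁻¹ := by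
    rw [← div_eq_mul_inv, le_div_iff₀ ha]
    exact (mul_le_mul_of_nonneg_left haE (hcpos d).le).trans hcd
  have hν : ENNReal.ofReal (2 * c d) *
      ((2 : ℝ≥0∞)⁻¹ • volume.restrict (Set.Icc (-1 : ℝ) 1)) A =
        ENNReal.ofReal (c d) * volume (A ∩ Set.Icc (-1) 1) := by
    rw [Measure.smul_apply, Measure.restrict_apply hA, smul_eq_mul, ← mul_assoc,
      ENNReal.ofReal_mul zero_le_two, ENNReal.ofReal_ofNat, mul_right_comm 2,
      ENNReal.mul_inv_cancel two_ne_zero ENNReal.ofNat_ne_top, one_mul]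
  rw [hν]
  exact (mul_le_mul_left (ENNReal.ofReal_le_ofReal hda) _).trans
    (le_map_affine_of_le_density hεmeas hεlaw (hcpos m).le (hcf m) ha hbm hA)
end
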